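/- Let G be a finite simple graph with girth at least 8. If G has no good set, then the b-chromatic number of G equals m(G) - 1. -/

import Mathlib

open SimpleGraph Finset

/-- A vertex `u` is a b-vertex for the coloring `C` if `u` has a neighbor colored
with each color different from its own. -/
def IsBVertex {V : Type*} (G : SimpleGraph V) {k : ℕ} (C : V → Fin k) (u : V) : Prop :=
  ∀ j : Fin k, j ≠ C u → ∃ w, G.Adj u w ∧ C w = j

/-- A b-coloring of `G` with `k` colors: a proper coloring with colors `Fin k` such that
every color class contains a b-vertex (in particular every color is used). -/
def IsBColoring {V : Type*} (G : SimpleGraph V) (k : ℕ) (C : V → Fin k) : Prop :=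
  (∀ u v, G.Adj u v → C u ≠ C v) ∧
  (∀ i : Fin k, ∃ u, C u = i ∧ IsBVertex G C u)

/-- The b-chromatic number: the largest `k` such that `G` has a b-coloring with `k` colors. -/
noncomputable def bChromatic {V : Type*} (G : SimpleGraph V) : ℕ :=
  sSup {k : ℕ | ∃ C : V → Fin k, IsBColoring G k C}

/-- `m(G)`: the largest `k` such that `G` has at least `k` vertices of degree at least `k - 1`. -/
noncomputable def mParam {V : Type*} [Fintype V] (G : SimpleGraph V) [DecidableRel G.Adj] : ℕ :=
  sSup {k : ℕ | k ≤ (Finset.univ.filter fun v => k - 1 ≤ G.degree v).card}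

/-- The set `M(G)` of dense vertices, i.e. vertices of degree at least `m(G) - 1`. -/
noncomputable def denseSet {V : Type*} [Fintype V] (G : SimpleGraph V) [DecidableRel G.Adj] :
    Finset V :=
  Finset.univ.filter fun v => mParam G - 1 ≤ G.degree v

/-- `W` encircles `u` if every `v ∈ W` is adjacent to `u` or has a common neighbor
`w ∈ W` with `u` such that `deg w = m(G) - 1`. -/
def Encircles {V : Type*} [Fintype V] (G : SimpleGraph V) [DecidableRel G.Adj]
    (W : Finset V) (u : V) : Prop :=
  ∀ v ∈ W, G.Adj u v ∨ ∃ w ∈ W, G.Adj v w ∧ G.Adj u w ∧ G.degree w = mParam G - 1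

/-- A good set: a set `W ⊆ M(G)` of `m(G)` vertices that encircles no vertex outside `W`,
and such that every vertex outside `W` of degree at least `m(G)` has a neighbor in `W`. -/
def IsGoodSet {V : Type*} [Fintype V] (G : SimpleGraph V) [DecidableRel G.Adj]
    (W : Finset V) : Prop :=
  W.card = mParam G ∧
  (∀ v ∈ W, mParam G - 1 ≤ G.degree v) ∧
  (∀ u, u ∉ W → ¬ Encircles G W u) ∧
  (∀ x, x ∉ W → mParam G ≤ G.degree x → ∃ w ∈ W, G.Adj x w)

section ShortCycles

variable {V : Type*} {G : SimpleGraph V}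

lemma no_cycle_three (hg : 8 ≤ G.egirth) {a b c : V} (h1 : G.Adj a b) (h2 : G.Adj b c)
    (h3 : G.Adj c a) : False := by
  have h := (SimpleGraph.le_egirth.1 hg) a (.cons h1 (.cons h2 (.cons h3 .nil))) (by
    have := h1.ne; have := h2.ne; have := h3.ne
    simp [SimpleGraph.Walk.cons_isCycle_iff]
    grind)
  simp at h
  revert h; norm_cast

lemma no_cycle_four (hg : 8 ≤ G.egirth) {a b c d : V} (h1 : G.Adj a b) (h2 : G.Adj b c)
    (h3 : G.Adj c d) (h4 : G.Adj d a) (n1 : a ≠ c) (n2 : b ≠ d) : False := by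
  have h := (SimpleGraph.le_egirth.1 hg) a (.cons h1 (.cons h2 (.cons h3 (.cons h4 .nil)))) (by
    have := h1.ne; have := h2.ne; have := h3.ne; have := h4.ne
    simp [SimpleGraph.Walk.cons_isCycle_iff]
    grind)
  simp at h
  revert h; norm_cast

lemma no_cycle_five (hg : 8 ≤ G.egirth) {a b c d e : V} (h1 : G.Adj a b) (h2 : G.Adj b c)
    (h3 : G.Adj c d) (h4 : G.Adj d e) (h5 : G.Adj e a) (n1 : a ≠ c) (n2 : b ≠ d) (n3 : c ≠ e)
    (n4 : d ≠ a) (n5 : e ≠ b) : False := by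
  have h := (SimpleGraph.le_egirth.1 hg) a
    (.cons h1 (.cons h2 (.cons h3 (.cons h4 (.cons h5 .nil))))) (by
    have := h1.ne; have := h2.ne; have := h3.ne; have := h4.ne; have := h5.ne
    simp [SimpleGraph.Walk.cons_isCycle_iff]
    grind)
  simp at h
  revert h; norm_cast

lemma no_cycle_six (hg : 8 ≤ G.egirth) {a b c d e f : V} (h1 : G.Adj a b) (h2 : G.Adj b c)
    (h3 : G.Adj c d) (h4 : G.Adj d e) (h5 : G.Adj e f) (h6 : G.Adj f a) (n1 : a ≠ c)
    (n2 : b ≠ d) (n3 : c ≠ e) (n4 : d ≠ f) (n5 : e ≠ a) (n6 : f ≠ b) : False := by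
  have o1 : a ≠ d := by rintro rfl; exact no_cycle_three hg h1 h2 h3
  have o2 : b ≠ e := by rintro rfl; exact no_cycle_three hg h2 h3 h4
  have o3 : c ≠ f := by rintro rfl; exact no_cycle_three hg h3 h4 h5
  have h := (SimpleGraph.le_egirth.1 hg) a
    (.cons h1 (.cons h2 (.cons h3 (.cons h4 (.cons h5 (.cons h6 .nil)))))) (by
    have := h1.ne; have := h2.ne; have := h3.ne; have := h4.ne; have := h5.ne; have := h6.ne
    simp [SimpleGraph.Walk.cons_isCycle_iff]
    grind)
  simp at h
  revert h; norm_cast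

lemma no_cycle_seven (hg : 8 ≤ G.egirth) {a b c d e f g : V} (h1 : G.Adj a b) (h2 : G.Adj b c)
    (h3 : G.Adj c d) (h4 : G.Adj d e) (h5 : G.Adj e f) (h6 : G.Adj f g) (h7 : G.Adj g a)
    (n1 : a ≠ c) (n2 : b ≠ d) (n3 : c ≠ e) (n4 : d ≠ f) (n5 : e ≠ g) (n6 : f ≠ a)
    (n7 : g ≠ b) : False := by
  have o1 : a ≠ d := by rintro rfl; exact no_cycle_three hg h1 h2 h3
  have o2 : b ≠ e := by rintro rfl; exact no_cycle_three hg h2 h3 h4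
  have o3 : c ≠ f := by rintro rfl; exact no_cycle_three hg h3 h4 h5
  have o4 : d ≠ g := by rintro rfl; exact no_cycle_three hg h4 h5 h6
  have o5 : e ≠ a := by rintro rfl; exact no_cycle_three hg h5 h6 h7
  have o6 : f ≠ b := by rintro rfl; exact no_cycle_three hg h6 h7 h1
  have o7 : g ≠ c := by rintro rfl; exact no_cycle_three hg h7 h1 h2
  have h := (SimpleGraph.le_egirth.1 hg) a
    (.cons h1 (.cons h2 (.cons h3 (.cons h4 (.cons h5 (.cons h6 (.cons h7 .nil))))))) (by
    have := h1.ne; have := h2.ne; have := h3.ne; have := h4.ne; have := h5.ne; have := h6.ne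
    have := h7.ne
    simp [SimpleGraph.Walk.cons_isCycle_iff]
    grind)
  simp at h
  revert h; norm_cast

/-- If all vertices of `W` are reached from `u` by a path of length at most two in `W`, then
no other vertex has two neighbors in `W`. -/
lemma eq_of_adj_adj_of_encircled (hg : 8 ≤ G.egirth)
    {W : Finset V} {u : V} (henc : ∀ v ∈ W, G.Adj u v ∨ ∃ t ∈ W, G.Adj v t ∧ G.Adj u t)
    (hu : u ∉ W) {x v v' : V} (hxW : x ∉ W) (hxu : x ≠ u) (hv : v ∈ W) (hv' : v' ∈ W)
    (hxv : G.Adj x v) (hxv' : G.Adj x v') : v = v' := by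
  by_contra hne
  have hvu : v ≠ u := fun h => hu (h ▸ hv)
  have hvu' : v' ≠ u := fun h => hu (h ▸ hv')
  rcases henc v hv with h1 | ⟨t, ht, h1, h2⟩ <;> rcases henc v' hv' with h3 | ⟨s, hs, h3, h4⟩
  · exact no_cycle_four hg hxv h1.symm h3 hxv'.symm hxu hne
  · have hsx : s ≠ x := fun h => hxW (h ▸ hs)
    by_cases hvs : v = s
    · subst hvs
      exact no_cycle_three hg hxv h3.symm hxv'.symm
    · exact no_cycle_five hg hxv h1.symm h4 h3.symm hxv'.symm hxu hvs hvu'.symm hsx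
        (Ne.symm hne)
  · have htx : t ≠ x := fun h => hxW (h ▸ ht)
    by_cases hvt : v' = t
    · subst hvt
      exact no_cycle_three hg hxv h1 hxv'.symm
    · exact no_cycle_five hg hxv' h3.symm h2 h1.symm hxv.symm hxu hvt hvu.symm htx hne
  · have hsx : s ≠ x := fun h => hxW (h ▸ hs)
    have htx : t ≠ x := fun h => hxW (h ▸ ht)
    by_cases hts : t = s
    · subst hts
      exact no_cycle_four hg hxv h1 h3.symm hxv'.symm htx.symm hne
    · exact no_cycle_six hg hxv h1 h2.symm h4 h3.symm hxv'.symm htx.symm hvu hts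
        hvu'.symm hsx (Ne.symm hne)

/-- If all vertices of `W` are reached from `u` by a path of length at most two in `W`, then
the other neighbors of `W` are pairwise nonadjacent. -/
lemma not_adj_of_encircled (hg : 8 ≤ G.egirth)
    {W : Finset V} {u : V} (henc : ∀ v ∈ W, G.Adj u v ∨ ∃ t ∈ W, G.Adj v t ∧ G.Adj u t)
    (hu : u ∉ W) {x y v v' : V} (hxW : x ∉ W) (hxu : x ≠ u) (hyW : y ∉ W) (hyu : y ≠ u)
    (hv : v ∈ W) (hv' : v' ∈ W) (hxv : G.Adj x v) (hyv' : G.Adj y v') : ¬ G.Adj x y := by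
  intro hxy
  have hvu : v ≠ u := fun h => hu (h ▸ hv)
  have hvu' : v' ≠ u := fun h => hu (h ▸ hv')
  have hyv : v ≠ y := fun h => hyW (h ▸ hv)
  have hxv' : v' ≠ x := fun h => hxW (h ▸ hv')
  by_cases hne : v = v'
  · subst hne
    exact no_cycle_three hg hxv hyv'.symm hxy.symm
  rcases henc v hv with h1 | ⟨t, ht, h1, h2⟩ <;> rcases henc v' hv' with h3 | ⟨s, hs, h3, h4⟩
  · exact no_cycle_five hg hxv h1.symm h3 hyv'.symm hxy.symm hxu hne hyu.symm hxv' hyv.symm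
  · have hsy : s ≠ y := fun h => hyW (h ▸ hs)
    by_cases hvs : v = s
    · subst hvs
      exact no_cycle_four hg hxv h3.symm hyv'.symm hxy.symm hxv'.symm hyv
    · exact no_cycle_six hg hxv h1.symm h4 h3.symm hyv'.symm hxy.symm hxu hvs hvu'.symm hsy
        hxv' hyv.symm
  · have htx : t ≠ x := fun h => hxW (h ▸ ht)
    by_cases hvt : v' = t
    · subst hvt
      exact no_cycle_four hg hxv h1 hyv'.symm hxy.symm hxv'.symm hyv
    · exact no_cycle_six hg hyv' h3.symm h2 h1.symm hxv.symm hxy hyu hvt hvu.symm htx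
        hyv hxv'.symm
  · have hsy : s ≠ y := fun h => hyW (h ▸ hs)
    have htx : t ≠ x := fun h => hxW (h ▸ ht)
    by_cases hts : t = s
    · subst hts
      exact no_cycle_five hg hxv h1 h3.symm hyv'.symm hxy.symm htx.symm hne hsy hxv' hyv.symm
    · exact no_cycle_seven hg hxv h1 h2.symm h4 h3.symm hyv'.symm hxy.symm htx.symm hvu hts
        hvu'.symm hsy hxv' hyv.symm

end ShortCycles

/-- A transversal of b-vertices, one of each color. -/
lemma IsBColoring.exists_transversal {V : Type*} {G : SimpleGraph V} {k : ℕ} {C : V → Fin k}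
    (hC : IsBColoring G k C) :
    ∃ f : Fin k → V, (∀ i, C (f i) = i) ∧ (∀ i, IsBVertex G C (f i)) := by
  choose f hf using hC.2
  exact ⟨f, fun i => (hf i).1, fun i => (hf i).2⟩

section Parameter

variable {V : Type*} [Fintype V] (G : SimpleGraph V) [DecidableRel G.Adj]

lemma bddAbove_mParam_set :
    BddAbove {k : ℕ | k ≤ (Finset.univ.filter fun v => k - 1 ≤ G.degree v).card} :=
  ⟨Fintype.card V, fun _ hk => hk.trans (Finset.card_le_univ _)⟩

lemma le_mParam {k : ℕ} (hk : k ≤ (Finset.univ.filter fun v => k - 1 ≤ G.degree v).card) :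
    k ≤ mParam G :=
  le_csSup (bddAbove_mParam_set G) hk

lemma mParam_le_card_denseSet : mParam G ≤ (denseSet G).card :=
  Nat.sSup_mem (s := {k : ℕ | k ≤ (Finset.univ.filter fun v => k - 1 ≤ G.degree v).card})
    ⟨0, Nat.zero_le _⟩ (bddAbove_mParam_set G)

lemma card_degree_ge_mParam_le :
    (Finset.univ.filter fun v => mParam G ≤ G.degree v).card ≤ mParam G := by
  by_contra! h
  have : mParam G + 1 ≤ mParam G := le_mParam G (by simpa using h)
  omega

variable {G}

lemma IsBVertex.erase_subset_image {k : ℕ} {C : V → Fin k} {u : V}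
    (hu : IsBVertex G C u) : Finset.univ.erase (C u) ⊆ (G.neighborFinset u).image C := by
  intro j hj
  obtain ⟨w, hw, rfl⟩ := hu j (Finset.ne_of_mem_erase hj)
  exact Finset.mem_image_of_mem _ (by simpa using hw)

lemma IsBVertex.le_degree {k : ℕ} {C : V → Fin k} {u : V}
    (hu : IsBVertex G C u) : k - 1 ≤ G.degree u := by
  classical
  have := (Finset.card_le_card hu.erase_subset_image).trans Finset.card_image_le
  simpa using this

/-- A vertex of degree `k - 1` that is a b-vertex sees every color at most once. -/
lemma IsBVertex.eq_of_adj {k : ℕ} {C : V → Fin k} {u : V}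
    (hu : IsBVertex G C u) (hd : G.degree u = k - 1) {x y : V} (hx : G.Adj u x) (hy : G.Adj u y)
    (hxy : C x = C y) : x = y := by
  classical
  have h1 := Finset.card_le_card hu.erase_subset_image
  have h2 : ((G.neighborFinset u).image C).card = (G.neighborFinset u).card :=
    le_antisymm Finset.card_image_le (by simpa [hd] using h1)
  exact Finset.card_image_iff.1 h2 (by simpa using hx) (by simpa using hy) hxy

lemma IsBColoring.le_mParam {k : ℕ} {C : V → Fin k} (hC : IsBColoring G k C) :
    k ≤ mParam G := by
  classical
  obtain ⟨f, hf, hb⟩ := hC.exists_transversal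
  have hinj : Function.Injective f := fun i j hij => by rw [← hf i, ← hf j, hij]
  refine _root_.le_mParam G ?_
  calc k = (Finset.univ.image f).card := by rw [Finset.card_image_of_injective _ hinj]; simp
    _ ≤ _ := Finset.card_le_card fun x hx => by
      obtain ⟨i, -, rfl⟩ := Finset.mem_image.1 hx
      simpa using (hb i).le_degree

/-- If there are exactly `m(G)` dense vertices and they encircle some vertex, then there is no
b-coloring with `m(G)` colors. -/
lemma not_isBColoring_of_encircles {u : V} (hcard : (denseSet G).card = mParam G)
    (hu : u ∉ denseSet G) (henc : Encircles G (denseSet G) u) (C : V → Fin (mParam G)) :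
    ¬ IsBColoring G (mParam G) C := by
  classical
  intro hC
  obtain ⟨f, hf, hb⟩ := hC.exists_transversal
  have hinj : Function.Injective f := fun i j hij => by rw [← hf i, ← hf j, hij]
  have hsub : Finset.univ.image f ⊆ denseSet G := fun x hx => by
    obtain ⟨i, -, rfl⟩ := Finset.mem_image.1 hx
    simpa [denseSet] using (hb i).le_degree
  have heq : Finset.univ.image f = denseSet G := Finset.eq_of_subset_of_card_le hsub (by
    rw [Finset.card_image_of_injective _ hinj, hcard]; simp)
  have hmem : ∀ i, f i ∈ denseSet G := fun i => hsub (Finset.mem_image_of_mem _ (by simp))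
  rcases henc _ (hmem (C u)) with h | ⟨w, hw, h1, h2, hd⟩
  · exact hC.1 _ _ h (hf _).symm
  · rw [← heq] at hw
    obtain ⟨i, -, rfl⟩ := Finset.mem_image.1 hw
    have := (hb i).eq_of_adj hd h2.symm h1.symm (hf _).symm
    exact hu (this ▸ hmem _)

/-- The two branches below an encircled vertex of small degree. -/
lemma Encircles.exists_branches {W : Finset V} {u : V}
    (henc : Encircles G W u) (hu : u ∉ W) (hW : W.card = mParam G) (hdeg : G.degree u < mParam G) :
    ∃ v ∈ W, ∃ w ∈ W, ∃ w' ∈ W, ¬ G.Adj u v ∧ G.Adj v w ∧ G.Adj u w ∧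
      G.degree w = mParam G - 1 ∧ G.Adj u w' ∧ w' ≠ w := by
  classical
  obtain ⟨v, hv, huv⟩ : ∃ v ∈ W, ¬ G.Adj u v := by
    by_contra! h
    have : W ⊆ G.neighborFinset u := fun x hx => by simpa using h x hx
    have := Finset.card_le_card this
    rw [SimpleGraph.card_neighborFinset_eq_degree] at this
    omega
  obtain ⟨w, hw, hvw, huw, hd⟩ := (henc v hv).resolve_left huv
  refine ⟨v, hv, w, hw, ?_⟩
  by_contra! h
  have hall : ∀ x ∈ W, G.Adj u x → x = w := fun x hx hux => h x hx huv hvw huw hd hux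
  have hsub : insert u (W.erase w) ⊆ G.neighborFinset w := by
    intro x hx
    rw [SimpleGraph.mem_neighborFinset]
    rcases Finset.mem_insert.1 hx with rfl | hx
    · exact huw.symm
    · obtain ⟨hne, hxW⟩ := Finset.mem_erase.1 hx
      rcases henc x hxW with h' | ⟨t, ht, hxt, hut, -⟩
      · exact absurd (hall x hxW h') hne
      · rw [← hall t ht hut]; exact hxt.symm
  have h1 := Finset.card_le_card hsub
  rw [Finset.card_insert_of_notMem (by simp [hu]), Finset.card_erase_of_mem hw,
    SimpleGraph.card_neighborFinset_eq_degree] at h1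
  omega

/-- If `W` encircles `u` and there is a dense vertex outside `W` other than `u`, then exchanging it
with a suitable vertex of `W` yields a good set. -/
lemma exists_goodSet_of_exchange (hg : 8 ≤ G.egirth)
    {W : Finset V} {u y : V} (hW : W.card = mParam G) (hdense : ∀ v ∈ W, mParam G - 1 ≤ G.degree v)
    (hD : ∀ x, mParam G ≤ G.degree x → x ∈ W) (hu : u ∉ W) (henc : Encircles G W u)
    (hy : y ∉ W) (hyd : mParam G - 1 ≤ G.degree y) (hyu : y ≠ u) : ∃ W, IsGoodSet G W := by
  classical
  have hdu : G.degree u < mParam G := by by_contra! h; exact hu (hD u h)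
  obtain ⟨v, hv, w, hw, w', hw', huv, hvw, huw, hd, huw', hne⟩ :=
    henc.exists_branches hu hW hdu
  have hw'v : w' ≠ v := by rintro rfl; exact huv huw'
  have huv' : u ≠ v := by rintro rfl; exact hu hv
  have hvw' : ¬ G.Adj v w' := fun h => no_cycle_four hg huw'.symm huw hvw.symm h hne huv'
  have hww' : ¬ G.Adj w w' := fun h => no_cycle_three hg huw h huw'.symm
  have hwS : w ∉ insert y (W.erase w) := by
    simp only [Finset.mem_insert, Finset.mem_erase, not_or]
    exact ⟨fun h => hy (h ▸ hw), by simp⟩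
  have huS : u ∉ insert y (W.erase w) := by
    simp [hu, hyu.symm]
  have hvS : v ∈ insert y (W.erase w) := by simp [hv, hvw.ne]
  have hw'S : w' ∈ insert y (W.erase w) := by simp [hw', hne]
  refine ⟨insert y (W.erase w), ?_, ?_, ?_, ?_⟩
  · rw [Finset.card_insert_of_notMem (by simp [hy]), Finset.card_erase_of_mem hw]
    omega
  · intro x hx
    rcases Finset.mem_insert.1 hx with rfl | hx
    · exact hyd
    · exact hdense x (Finset.mem_of_mem_erase hx)
  · intro z hz hzenc
    have hzv : v ≠ z := fun h => hz (h ▸ hvS)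
    have hzw' : z ≠ w' := fun h => hz (h ▸ hw'S)
    rcases hzenc w' hw'S with h1 | ⟨t, ht, h1, h2, -⟩ <;>
      rcases hzenc v hvS with h3 | ⟨s, hs, h3, h4, -⟩
    · exact no_cycle_five hg huw'.symm huw hvw.symm h3.symm h1 hne huv'
        (fun h => hww' (h ▸ h1)) hw'v.symm (fun h => huv (h ▸ h3))
    · have hws : w ≠ s := fun h => hwS (h ▸ hs)
      by_cases hzu : z = u
      · subst hzu
        exact no_cycle_four hg huw hvw.symm h3 h4.symm huv' hws
      · exact no_cycle_six hg huw'.symm huw hvw.symm h3 h4.symm h1 hne huv' hws hzv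
          (fun h => hvw' (h ▸ h3)) hzu
    · have htu : t ≠ u := fun h => huS (h ▸ ht)
      by_cases hzw : z = w
      · subst hzw
        exact no_cycle_four hg huw'.symm huw h2 h1.symm hne htu.symm
      · exact no_cycle_six hg huw'.symm huw hvw.symm h3.symm h2 h1.symm hne huv'
          (Ne.symm hzw) (fun h => hvw' (h ▸ h1.symm)) hzw' htu
    · have htu : t ≠ u := fun h => huS (h ▸ ht)
      have hws : w ≠ s := fun h => hwS (h ▸ hs)
      by_cases hst : s = t
      · subst hst
        exact no_cycle_five hg huw'.symm huw hvw.symm h3 h1.symm hne huv' hws hw'v.symm htu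
      · exact no_cycle_seven hg huw'.symm huw hvw.symm h3 h4.symm h2 h1.symm hne huv' hws hzv
          hst hzw' htu
  · intro x hx hxd
    have hxW := hD x hxd
    have : x = w := by
      by_contra h
      exact hx (by simp [h, hxW])
    subst this
    omega

/-- If `W` encircles a dense vertex `u`, and all dense vertices other than `u` are in `W`, then
exchanging `u` with a suitable vertex of `W` yields a good set. -/
lemma exists_goodSet_of_encircles_dense
    (hg : 8 ≤ G.egirth) {W : Finset V} {u : V} (hW : W.card = mParam G)
    (hdense : ∀ v ∈ W, mParam G - 1 ≤ G.degree v) (hD : ∀ x, mParam G ≤ G.degree x → x ∈ W)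
    (hu : u ∉ W) (henc : Encircles G W u) (hud : mParam G - 1 ≤ G.degree u) :
    ∃ W, IsGoodSet G W := by
  classical
  have hdu : G.degree u < mParam G := by by_contra! h; exact hu (hD u h)
  obtain ⟨v, hv, w, hw, w', hw', huv, hvw, huw, hd, huw', hne⟩ :=
    henc.exists_branches hu hW hdu
  have hw'v : w' ≠ v := by rintro rfl; exact huv huw'
  have hww' : ¬ G.Adj w w' := fun h => no_cycle_three hg huw h huw'.symm
  have huS : u ∈ insert u (W.erase v) := by simp
  have hwS : w ∈ insert u (W.erase v) := by simp [hw, hvw.ne']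
  have hw'S : w' ∈ insert u (W.erase v) := by simp [hw', hw'v]
  refine ⟨insert u (W.erase v), ?_, ?_, ?_, ?_⟩
  · rw [Finset.card_insert_of_notMem (by simp [hu]), Finset.card_erase_of_mem hv]
    omega
  · intro x hx
    rcases Finset.mem_insert.1 hx with rfl | hx
    · exact hud
    · exact hdense x (Finset.mem_of_mem_erase hx)
  · intro z hz hzenc
    have hzu : u ≠ z := fun h => hz (h ▸ huS)
    have hzw : z ≠ w := fun h => hz (h ▸ hwS)
    have hzw' : z ≠ w' := fun h => hz (h ▸ hw'S)
    have hadj : G.Adj u z := by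
      by_contra huz
      rcases hzenc w hwS with h1 | ⟨s, hs, h1, h2, -⟩ <;>
        rcases hzenc w' hw'S with h3 | ⟨t, ht, h3, h4, -⟩
      · exact no_cycle_four hg huw.symm huw' h3.symm h1 hne.symm hzu
      · exact no_cycle_five hg huw.symm huw' h3 h4.symm h1 hne.symm
          (fun h => huz (h ▸ h4.symm)) hzw'.symm (fun h => hww' (h ▸ h3.symm)) hzu.symm
      · exact no_cycle_five hg huw'.symm huw h1 h2.symm h3 hne
          (fun h => huz (h ▸ h2.symm)) hzw.symm (fun h => hww' (h ▸ h1)) hzu.symm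
      · have hsu : s ≠ u := fun h => huz (h ▸ h2.symm)
        have htu : u ≠ t := fun h => huz (h ▸ h4.symm)
        by_cases hts : t = s
        · subst hts
          exact no_cycle_four hg huw.symm huw' h3 h1.symm hne.symm htu
        · exact no_cycle_six hg huw.symm huw' h3 h4.symm h2 h1.symm hne.symm htu hzw'.symm
            hts hzw hsu
    have hzW : z ∉ W := fun h => hz (by
      have : z ≠ v := by rintro rfl; exact huv hadj
      simp [h, this])
    have hall : ∀ x ∈ W, x ≠ v → G.Adj u x := by
      intro x hx hxv
      by_contra hux
      obtain ⟨t, ht, hxt, hut, -⟩ := (henc x hx).resolve_left hux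
      have hxu : x ≠ u := fun h => hu (h ▸ hx)
      have hzt : z ≠ t := fun h => hzW (h ▸ ht)
      rcases hzenc x (by simp [hx, hxv]) with h1 | ⟨s, hs, h1, h2, -⟩
      · exact no_cycle_four hg h1 hxt hut.symm hadj hzt hxu
      · exact no_cycle_five hg h2 h1.symm hxt hut.symm hadj (fun h => hzW (h ▸ hx))
          (fun h => no_cycle_three hg hut (h ▸ h2.symm) hadj.symm) hxu hzt.symm
          (fun h => hux (h ▸ h1.symm))
    have hsub : insert z (W.erase v) ⊆ G.neighborFinset u := by
      intro x hx
      rw [SimpleGraph.mem_neighborFinset]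
      rcases Finset.mem_insert.1 hx with rfl | hx
      · exact hadj
      · exact hall x (Finset.mem_of_mem_erase hx) (Finset.ne_of_mem_erase hx)
    have h1 := Finset.card_le_card hsub
    rw [Finset.card_insert_of_notMem (by simp [hzW]), Finset.card_erase_of_mem hv,
      SimpleGraph.card_neighborFinset_eq_degree] at h1
    omega
  · intro x hx hxd
    have hxW := hD x hxd
    have : x = v := by
      by_contra h
      exact hx (by simp [h, hxW])
    subst this
    exact ⟨w, hwS, hvw⟩

/-- Greedy extension of a partial proper coloring to vertices of small degree. -/
lemma exists_proper_extension {k : ℕ} (S : Finset V)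
    (c : V → Fin k) (hc : ∀ x ∈ S, ∀ y ∈ S, G.Adj x y → c x ≠ c y)
    (hdeg : ∀ x ∉ S, G.degree x < k) :
    ∃ C : V → Fin k, (∀ x ∈ S, C x = c x) ∧ ∀ x y, G.Adj x y → C x ≠ C y := by
  classical
  induction hn : Sᶜ.card generalizing S c with
  | zero =>
    have hS : S = Finset.univ := by simpa using hn
    subst hS
    exact ⟨c, fun _ _ => rfl, fun x y => hc x (by simp) y (by simp)⟩
  | succ n ih =>
    obtain ⟨x, hx⟩ : Sᶜ.Nonempty := Finset.card_pos.1 (by omega)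
    rw [Finset.mem_compl] at hx
    obtain ⟨a, ha⟩ : ∃ a, a ∉ (G.neighborFinset x).image c := by
      by_contra! h
      have h1 : (Finset.univ : Finset (Fin k)) ⊆ (G.neighborFinset x).image c := fun a _ => h a
      have h2 := (Finset.card_le_card h1).trans Finset.card_image_le
      have h3 := hdeg x hx
      simp at h2
      omega
    have ha' : ∀ y, G.Adj x y → c y ≠ a := fun y hy h =>
      ha (Finset.mem_image.2 ⟨y, by simpa using hy, h⟩)
    obtain ⟨C, hC, hCp⟩ := ih (insert x S) (Function.update c x a) (by
      intro y hy z hz hyz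
      rcases Finset.mem_insert.1 hy with rfl | hy <;> rcases Finset.mem_insert.1 hz with rfl | hz
      · exact absurd hyz G.irrefl
      · rw [Function.update_self, Function.update_of_ne hyz.ne']
        exact (ha' z hyz).symm
      · rw [Function.update_self, Function.update_of_ne hyz.ne]
        exact ha' y hyz.symm
      · have h1 : y ≠ x := fun h => hx (h ▸ hy)
        have h2 : z ≠ x := fun h => hx (h ▸ hz)
        rw [Function.update_of_ne h1, Function.update_of_ne h2]
        exact hc y hy z hz hyz)
      (fun y hy => hdeg y fun h : y ∈ S => hy (Finset.mem_insert_of_mem h))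
      (by rw [Finset.compl_insert, Finset.card_erase_of_mem (by simpa using hx)]; omega)
    refine ⟨C, fun y hy => ?_, hCp⟩
    rw [hC y (Finset.mem_insert_of_mem hy), Function.update_of_ne (ne_of_mem_of_not_mem hy hx)]

/-- If the `k + 1` vertices of degree at least `k` encircle a vertex, then there is a b-coloring
with `k` colors. -/
lemma exists_isBColoring_of_encircled
    (hg : 8 ≤ G.egirth) {k : ℕ} {W : Finset V} {u v₀ w w' : V} (hW : W.card = k + 1)
    (hdense : ∀ v ∈ W, k ≤ G.degree v) (hdeg : ∀ x ∉ W, G.degree x < k)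
    (henc : ∀ v ∈ W, G.Adj u v ∨ ∃ t ∈ W, G.Adj v t ∧ G.Adj u t) (hu : u ∉ W)
    (hv₀ : v₀ ∈ W) (hw' : w' ∈ W) (huv : ¬ G.Adj u v₀) (hvw : G.Adj v₀ w)
    (huw : G.Adj u w) (huw' : G.Adj u w') (hne : w' ≠ w) :
    ∃ C : V → Fin k, IsBColoring G k C := by
  classical
  have hw'v : w' ≠ v₀ := by rintro rfl; exact huv huw'
  have huv₀ : u ≠ v₀ := by rintro rfl; exact hu hv₀
  have hvw' : ¬ G.Adj v₀ w' := fun h => no_cycle_four hg huw'.symm huw hvw.symm h hne huv₀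
  have hww' : ¬ G.Adj w w' := fun h => no_cycle_three hg huw h huw'.symm
  have hcommon : ∀ v ∈ W, G.Adj v v₀ → ¬ G.Adj v w' := fun v hv h1 h2 =>
    no_cycle_five hg h2 huw'.symm huw hvw.symm h1.symm (fun h => hu (h ▸ hv)) hne huv₀
      (fun h => hww' (h ▸ h2)) hw'v.symm
  have hw'B : w' ∈ W.erase v₀ := by simp [hw', hw'v]
  let e : ↥(W.erase v₀) ≃ Fin k :=
    Finset.equivFinOfCardEq (by rw [Finset.card_erase_of_mem hv₀]; omega)
  let c : V → Fin k := fun x => if h : x ∈ W.erase v₀ then e ⟨x, h⟩ else e ⟨w', hw'B⟩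
  have hcB : ∀ x (h : x ∈ W.erase v₀), c x = e ⟨x, h⟩ := fun x h => dif_pos h
  have hcinj : ∀ x ∈ W.erase v₀, ∀ y ∈ W.erase v₀, c x = c y → x = y := by
    intro x hx y hy h
    rw [hcB x hx, hcB y hy] at h
    simpa using h
  have hcv₀ : c v₀ = c w' := by
    rw [hcB w' hw'B]
    exact dif_neg (by simp)
  have hcsurj : ∀ i, ∃ x ∈ W.erase v₀, c x = i := fun i =>
    ⟨e.symm i, (e.symm i).2, by rw [hcB _ (e.symm i).2]; simp⟩
  have hcW : ∀ x ∈ W, ∀ y ∈ W, c x = c y → x = y ∨ (x = v₀ ∧ y = w') ∨ (x = w' ∧ y = v₀) := by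
    intro x hx y hy h
    by_cases hxv : x = v₀ <;> by_cases hyv : y = v₀
    · exact .inl (hxv.trans hyv.symm)
    · refine .inr (.inl ⟨hxv, (hcinj w' hw'B y (by simp [hyv, hy]) ?_).symm⟩)
      rw [← hcv₀, ← hxv, h]
    · refine .inr (.inr ⟨hcinj x (by simp [hxv, hx]) w' hw'B ?_, hyv⟩)
      rw [← hcv₀, ← hyv, h]
    · exact .inl (hcinj x (by simp [hxv, hx]) y (by simp [hyv, hy]) h)
  have hcprop : ∀ x ∈ W, ∀ y ∈ W, G.Adj x y → c x ≠ c y := by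
    intro x hx y hy hxy h
    rcases hcW x hx y hy h with rfl | ⟨rfl, rfl⟩ | ⟨rfl, rfl⟩
    · exact G.irrefl hxy
    · exact hvw' hxy
    · exact hvw' hxy.symm
  let R : V → Finset (Fin k) := fun v =>
    Finset.univ.filter fun j => j ≠ c v ∧ ∀ x ∈ W, G.Adj v x → c x ≠ j
  let N : V → Finset V := fun v => (G.neighborFinset v).filter fun x => x ∉ W ∧ x ≠ u
  have hRN : ∀ v ∈ W, (R v).card ≤ (N v).card := by
    intro v hv
    let A := (G.neighborFinset v).filter fun x => x ∈ W
    have hAinj : Set.InjOn c A := by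
      intro x hx y hy h
      simp only [A, Finset.coe_filter, SimpleGraph.mem_neighborFinset, Set.mem_ofPred_eq] at hx hy
      rcases hcW x hx.2 y hy.2 h with h | ⟨rfl, rfl⟩ | ⟨rfl, rfl⟩
      · exact h
      · exact absurd hy.1 (hcommon v hv hx.1)
      · exact absurd hx.1 (hcommon v hv hy.1)
    have hdisj : Disjoint (R v) (insert (c v) (A.image c)) := by
      rw [Finset.disjoint_left]
      intro j hj hj'
      simp only [R, Finset.mem_filter, Finset.mem_univ, true_and] at hj
      rcases Finset.mem_insert.1 hj' with h | h
      · exact hj.1 h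
      · obtain ⟨x, hx, rfl⟩ := Finset.mem_image.1 h
        simp only [A, Finset.mem_filter, SimpleGraph.mem_neighborFinset] at hx
        exact hj.2 x hx.2 hx.1 rfl
    have hcv : c v ∉ A.image c := by
      intro h
      obtain ⟨x, hx, h⟩ := Finset.mem_image.1 h
      simp only [A, Finset.mem_filter, SimpleGraph.mem_neighborFinset] at hx
      exact hcprop v hv x hx.2 hx.1 h.symm
    have h1 := Finset.card_le_univ (R v ∪ insert (c v) (A.image c))
    rw [Finset.card_union_of_disjoint hdisj, Finset.card_insert_of_notMem hcv,
      Finset.card_image_of_injOn hAinj, Fintype.card_fin] at h1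
    have hsub : G.neighborFinset v ⊆ N v ∪ insert u A := by
      intro x hx
      simp only [N, A, Finset.mem_union, Finset.mem_filter, Finset.mem_insert]
      tauto
    have h2 := (Finset.card_le_card hsub).trans (Finset.card_union_le _ _)
    have h3 := Finset.card_insert_le u A
    rw [SimpleGraph.card_neighborFinset_eq_degree] at h2
    have := hdense v hv
    omega
  have hr : ∀ v, ∃ r : Fin k → V, v ∈ W →
      (∀ j ∈ R v, r j ∈ N v) ∧ ∀ i ∈ R v, ∀ j ∈ R v, r i = r j → i = j := by
    intro v
    by_cases hv : v ∈ W
    · obtain ⟨f⟩ : Nonempty (↥(R v) ↪ ↥(N v)) :=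
        Function.Embedding.nonempty_of_card_le (by simpa using hRN v hv)
      refine ⟨fun j => if h : j ∈ R v then f ⟨j, h⟩ else v, fun _ => ⟨fun j hj => ?_, ?_⟩⟩
      · simp only [dif_pos hj]
        exact (f ⟨j, hj⟩).2
      · intro i hi j hj h
        simp only [dif_pos hi, dif_pos hj] at h
        simpa using f.injective (Subtype.ext h)
    · exact ⟨fun _ => v, fun h => absurd h hv⟩
  choose r hr using hr
  have hrN : ∀ v ∈ W, ∀ j ∈ R v, r v j ∉ W ∧ r v j ≠ u ∧ G.Adj (r v j) v := by
    intro v hv j hj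
    have := (hr v hv).1 j hj
    simp only [N, Finset.mem_filter, SimpleGraph.mem_neighborFinset] at this
    exact ⟨this.2.1, this.2.2, this.1.symm⟩
  let Q : V → Fin k → Prop := fun x j => ∃ v ∈ W, j ∈ R v ∧ r v j = x
  have hQ : ∀ x i j, Q x i → Q x j → i = j := by
    rintro x i j ⟨v, hv, hi, rfl⟩ ⟨v', hv', hj, h⟩
    obtain ⟨h1, h2, h3⟩ := hrN v hv i hi
    obtain ⟨-, -, h4⟩ := hrN v' hv' j hj
    rw [h] at h4
    obtain rfl := eq_of_adj_adj_of_encircled hg henc hu h1 h2 hv hv' h3 h4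
    exact (hr v hv).2 i hi j hj h.symm
  let c' : V → Fin k := fun x => if h : ∃ j, Q x j then h.choose else c x
  have hc'Q : ∀ x j, Q x j → c' x = j := by
    intro x j hj
    have h : ∃ j, Q x j := ⟨j, hj⟩
    have : c' x = h.choose := dif_pos h
    rw [this]
    exact hQ x _ _ h.choose_spec hj
  have hc'W : ∀ x ∈ W, c' x = c x := by
    intro x hx
    refine dif_neg ?_
    rintro ⟨j, v, hv, hj, rfl⟩
    exact (hrN v hv j hj).1 hx
  have hWQ : ∀ x ∈ W, ∀ y j, Q y j → G.Adj x y → c' x ≠ c' y := by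
    intro x hx y j hj hxy
    rw [hc'W x hx, hc'Q y j hj]
    obtain ⟨v, hv, hj, rfl⟩ := hj
    obtain ⟨h1, h2, h3⟩ := hrN v hv j hj
    obtain rfl := eq_of_adj_adj_of_encircled hg henc hu h1 h2 hv hx h3 hxy.symm
    simp only [R, Finset.mem_filter] at hj
    exact hj.2.1.symm
  obtain ⟨C, hC, hCp⟩ := exists_proper_extension
    (Finset.univ.filter fun x => x ∈ W ∨ ∃ j, Q x j) c' (by
      intro x hx y hy hxy
      simp only [Finset.mem_filter, Finset.mem_univ, true_and] at hx hy
      rcases hx with hx | ⟨i, hx⟩ <;> rcases hy with hy | ⟨j, hy⟩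
      · rw [hc'W x hx, hc'W y hy]
        exact hcprop x hx y hy hxy
      · exact hWQ x hx y j hy hxy
      · exact (hWQ y hy x i hx hxy.symm).symm
      · obtain ⟨v, hv, hi, rfl⟩ := hx
        obtain ⟨v', hv', hj, rfl⟩ := hy
        obtain ⟨h1, h2, h3⟩ := hrN v hv i hi
        obtain ⟨h4, h5, h6⟩ := hrN v' hv' j hj
        exact absurd hxy (not_adj_of_encircled hg henc hu h1 h2 h4 h5 hv hv' h3 h6))
    (fun x hx => hdeg x fun h => hx (by simp [h]))
  have hCW : ∀ x ∈ W, C x = c x := fun x hx => by rw [hC x (by simp [hx]), hc'W x hx]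
  refine ⟨C, hCp, fun i => ?_⟩
  obtain ⟨v, hvB, rfl⟩ := hcsurj i
  have hv := Finset.mem_of_mem_erase hvB
  refine ⟨v, hCW v hv, fun j hj => ?_⟩
  rw [hCW v hv] at hj
  by_cases hex : ∃ x ∈ W, G.Adj v x ∧ c x = j
  · obtain ⟨x, hx, hvx, rfl⟩ := hex
    exact ⟨x, hvx, hCW x hx⟩
  · have hjR : j ∈ R v := by
      simp only [R, Finset.mem_filter, Finset.mem_univ, true_and]
      exact ⟨hj, fun x hx hvx h => hex ⟨x, hx, hvx, h⟩⟩
    have hq : Q (r v j) j := ⟨v, hv, hjR, rfl⟩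
    refine ⟨r v j, (hrN v hv j hjR).2.2.symm, ?_⟩
    rw [hC _ (by simp only [Finset.mem_filter, Finset.mem_univ, true_and]; exact .inr ⟨j, hq⟩),
      hc'Q _ _ hq]

end Parameter

/-- If `G` has girth at least 8 and no good set, then `χ_b(G) = m(G) - 1`. -/
theorem bChromatic_eq_of_no_goodSet {V : Type*} [Fintype V] (G : SimpleGraph V)
    [DecidableRel G.Adj] (hg : 8 ≤ G.egirth) (h : ¬ ∃ W : Finset V, IsGoodSet G W) :
    bChromatic G = mParam G - 1 := by
  classical
  have hDM : (Finset.univ.filter fun v => mParam G ≤ G.degree v) ⊆ denseSet G := by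
    intro x hx
    simp only [denseSet, Finset.mem_filter, Finset.mem_univ, true_and] at hx ⊢
    omega
  obtain ⟨W, hDW, hWM, hW⟩ := Finset.exists_subsuperset_card_eq hDM
    (card_degree_ge_mParam_le G) (mParam_le_card_denseSet G)
  have hD : ∀ x, mParam G ≤ G.degree x → x ∈ W := fun x hx => hDW (by simpa using hx)
  have hdense : ∀ v ∈ W, mParam G - 1 ≤ G.degree v := fun v hv => by
    simpa [denseSet] using hWM hv
  obtain ⟨u, hu, henc⟩ : ∃ u, u ∉ W ∧ Encircles G W u := by
    by_contra! hcon
    exact h ⟨W, hW, hdense, hcon, fun x hx hxd => absurd (hD x hxd) hx⟩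
  have hdu : G.degree u < mParam G := by
    by_contra! hcon
    exact hu (hD u hcon)
  have hMW : ∀ y, mParam G - 1 ≤ G.degree y → y ∈ W := by
    intro y hyd
    by_contra hy
    by_cases hyu : y = u
    · exact h (exists_goodSet_of_encircles_dense hg hW hdense hD hu henc (hyu ▸ hyd))
    · exact h (exists_goodSet_of_exchange hg hW hdense hD hu henc hy hyd hyu)
  obtain rfl : W = denseSet G := Finset.Subset.antisymm hWM fun y hy =>
    hMW y (by simpa [denseSet] using hy)
  obtain ⟨v, hv, w, -, w', hw', huv, hvw, huw, -, huw', hne⟩ :=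
    henc.exists_branches hu hW hdu
  have hcol : ∃ C : V → Fin (mParam G - 1), IsBColoring G (mParam G - 1) C :=
    exists_isBColoring_of_encircled hg (by omega) hdense
      (fun x hx => by by_contra! hcon; exact hx (hMW x hcon))
      (fun x hx => (henc x hx).imp_right fun ⟨t, ht, h1, h2, _⟩ => ⟨t, ht, h1, h2⟩)
      hu hv hw' huv hvw huw huw' hne
  have hub : ∀ k ∈ {k : ℕ | ∃ C : V → Fin k, IsBColoring G k C}, k ≤ mParam G - 1 := by
    rintro k ⟨C, hC⟩
    have hk := hC.le_mParam
    have hkm : k ≠ mParam G := by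
      rintro rfl
      exact not_isBColoring_of_encircles hW hu henc C hC
    omega
  exact le_antisymm (csSup_le ⟨_, hcol⟩ hub) (le_csSup ⟨_, hub⟩ hcol)
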